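/- arXiv:2105.10928 — 2 statements merged into one kernel-verified Lean document; each statement's English description precedes it below -/
import Mathlib

section
/- There is an absolute constant C > 0 such that the following holds. Let u = u(t,x) (t ≥ 0, x ∈ ℝ²) be smooth and compactly supported in {(t,x) : |x| ≤ 1 + t}. Then for every t ≥ 0 and every x ∈ ℝ², ⟨|x| − t⟩^{−1} |u(t,x)| ≤ C ⟨x⟩^{−1/2} ‖(∂Γ^{≤1} u)(t,·)‖_{L²(ℝ²)}. -/
open MeasureTheory Real

noncomputable section

/-- Spacetime ℝ_t × ℝ²_x; coordinate 0 is time, coordinates 1, 2 are space. -/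
abbrev Spt := Fin 3 → ℝ
/-- Space ℝ². -/
abbrev Sp := Fin 2 → ℝ

/-- Partial derivative ∂_i on spacetime (∂_0 = ∂_t). -/
def pd (i : Fin 3) (u : Spt → ℝ) : Spt → ℝ :=
  fun y => fderiv ℝ u y (Pi.single i 1)

/-- Spatial partial derivative ∂_i on ℝ² (index 0 ↔ x₁, index 1 ↔ x₂). -/
def spd (i : Fin 2) (f : Sp → ℝ) : Sp → ℝ :=
  fun x => fderiv ℝ f x (Pi.single i 1)

/-- The wave operator □ = ∂_tt − Δ. -/
def Box (u : Spt → ℝ) : Spt → ℝ :=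
  fun y => pd 0 (pd 0 u) y - pd 1 (pd 1 u) y - pd 2 (pd 2 u) y

/-- r = |x|, the spatial Euclidean norm of a spacetime point. -/
def rad (y : Spt) : ℝ := Real.sqrt ((y 1) ^ 2 + (y 2) ^ 2)

/-- The Euclidean norm on ℝ². -/
def nrm2 (x : Sp) : ℝ := Real.sqrt ((x 0) ^ 2 + (x 1) ^ 2)

/-- ω₀ = −1, ω_i = x_i / |x| for i = 1, 2. -/
def om (i : Fin 3) (y : Spt) : ℝ := if i = 0 then -1 else y i / rad y

/-- The good derivatives T_i = ω_i ∂_t + ∂_i (note T_0 = 0). -/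
def Td (i : Fin 3) (u : Spt → ℝ) : Spt → ℝ :=
  fun y => om i y * pd 0 u y + pd i u y

/-- The vector fields Γ = (∂_t, ∂_1, ∂_2, ∂_θ, L₀) (no Lorentz boosts). -/
def Gam : Fin 5 → (Spt → ℝ) → Spt → ℝ :=
  ![pd 0, pd 1, pd 2,
    fun u y => y 1 * pd 2 u y - y 2 * pd 1 u y,
    fun u y => y 0 * pd 0 u y + y 1 * pd 1 u y + y 2 * pd 2 u y]

/-- Γ^α = Γ₁^{α₁} ∘ Γ₂^{α₂} ∘ Γ₃^{α₃} ∘ Γ₄^{α₄} ∘ Γ₅^{α₅}. -/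
def GamPow (α : Fin 5 → ℕ) (u : Spt → ℝ) : Spt → ℝ :=
  (Gam 0)^[α 0] <| (Gam 1)^[α 1] <| (Gam 2)^[α 2] <| (Gam 3)^[α 3] <| (Gam 4)^[α 4] u

/-- The multi-indices α with |α| ≤ k. -/
def midx (k : ℕ) : Finset (Fin 5 → ℕ) :=
  (Fintype.piFinset fun _ => Finset.range (k + 1)).filter fun α => (∑ i, α i) ≤ k

/-- The Japanese bracket ⟨s⟩ = (1 + s²)^{1/2}. -/
def jb (s : ℝ) : ℝ := Real.sqrt (1 + s ^ 2)

/-- The spacetime point (t, x). -/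
def st (t : ℝ) (x : Sp) : Spt := ![t, x 0, x 1]

/-- The null vector (−1, cos θ, sin θ). -/
def nullVec (θ : ℝ) : Fin 3 → ℝ := ![(-1 : ℝ), Real.cos θ, Real.sin θ]

/-- The standard null condition: g^{kij} ω_k ω_i ω_j = 0 for all null ω. -/
def NullCond (g : Fin 3 → Fin 3 → Fin 3 → ℝ) : Prop :=
  ∀ θ : ℝ, ∑ k, ∑ i, ∑ j, g k i j * nullVec θ k * nullVec θ i * nullVec θ j = 0

/-- The quadratic nonlinearity g^{kij} ∂_k u ∂_{ij} u. -/
def Quad (g : Fin 3 → Fin 3 → Fin 3 → ℝ) (u : Spt → ℝ) : Spt → ℝ :=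
  fun y => ∑ k, ∑ i, ∑ j, g k i j * pd k u y * pd i (pd j u) y

/-- The energy E_J(u(t,·)) = Σ_{|α|≤J} ‖(∂Γ^α u)(t,·)‖²_{L²(ℝ²)}. -/
def energy (J : ℕ) (u : Spt → ℝ) (t : ℝ) : ℝ :=
  ∑ α ∈ midx J, ∑ i : Fin 3, ∫ x : Sp, (pd i (GamPow α u) (st t x)) ^ 2

/-- The L² norm on ℝ². -/
def L2 (f : Sp → ℝ) : ℝ := Real.sqrt (∫ x : Sp, (f x) ^ 2)

/-- One-dimensional Sobolev inequality on an interval of length at least one. -/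
theorem sq_le_two_mul_integral {h h' : ℝ → ℝ} (hd : ∀ s, HasDerivAt h (h' s) s)
    (hc : Continuous h') {a b x : ℝ} (hab : a + 1 ≤ b) (hx : x ∈ Set.Icc a b) :
    h x ^ 2 ≤ 2 * ∫ s in a..b, (h s ^ 2 + h' s ^ 2) := by
  have hcont : Continuous h := continuous_iff_continuousAt.2 fun s => (hd s).continuousAt
  set H := ∫ s in a..b, (h s ^ 2 + h' s ^ 2) with hH
  have hle : a ≤ b := by linarith
  have hint : ∀ c d : ℝ, IntervalIntegrable (fun s => h s ^ 2 + h' s ^ 2) volume c d :=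
    fun c d => (by fun_prop : Continuous fun s => h s ^ 2 + h' s ^ 2).intervalIntegrable c d
  have hH0 : 0 ≤ H := intervalIntegral.integral_nonneg hle fun s _ => by positivity
  have key : ∀ y ∈ Set.Icc a b, h x ^ 2 ≤ h y ^ 2 + H := by
    intro y hy
    have e : ∫ s in y..x, 2 * h s * h' s = h x ^ 2 - h y ^ 2 := by
      apply intervalIntegral.integral_eq_sub_of_hasDerivAt (f := fun s => h s ^ 2)
      · intro s _
        exact ((hd s).pow 2).congr_deriv (by norm_num)
      · exact (by fun_prop : Continuous fun s => 2 * h s * h' s).intervalIntegrable _ _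
    have b1 : |∫ s in y..x, 2 * h s * h' s| ≤ |∫ s in y..x, (h s ^ 2 + h' s ^ 2)| := by
      rw [← Real.norm_eq_abs]
      refine intervalIntegral.norm_integral_le_abs_of_norm_le ?_ (hint _ _)
      refine Filter.Eventually.of_forall fun s => ?_
      rw [Real.norm_eq_abs, abs_le]
      constructor <;> nlinarith [sq_nonneg (h s + h' s), sq_nonneg (h s - h' s)]
    have b2 : |∫ s in y..x, (h s ^ 2 + h' s ^ 2)| ≤ |H| := by
      refine intervalIntegral.abs_integral_mono_interval ?_ ?_ (hint _ _)
      · rw [Set.uIoc_of_le hle]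
        exact Set.Ioc_subset_Ioc (le_min hy.1 hx.1) (max_le hy.2 hx.2)
      · exact Filter.Eventually.of_forall fun s => by simp only [Pi.zero_apply]; positivity
    rw [e] at b1
    rw [abs_of_nonneg hH0] at b2
    linarith [le_abs_self (h x ^ 2 - h y ^ 2)]
  have i1 : ∫ y in a..b, (h x ^ 2 - H) ≤ ∫ y in a..b, (h y ^ 2 + h' y ^ 2) := by
    refine intervalIntegral.integral_mono_on hle (by simp) (hint _ _) fun y hy => ?_
    nlinarith [key y hy, sq_nonneg (h' y)]
  rw [intervalIntegral.integral_const, smul_eq_mul, ← hH] at i1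
  by_contra hcon
  push Not at hcon
  nlinarith

/-- Radial Hardy inequality in dimension two, with weight singular just outside the support. -/
theorem integral_radial_hardy {h h' : ℝ → ℝ} (hd : ∀ s, HasDerivAt h (h' s) s)
    (hc : Continuous h') {R : ℝ} (hR : 0 ≤ R) (h0 : h R = 0) :
    ∫ s in (0 : ℝ)..R, s * (h s ^ 2 / (1 + |R - s|) ^ 2) ≤
      4 * ∫ s in (0 : ℝ)..R, s * h' s ^ 2 := by
  have hcont : Continuous h := continuous_iff_continuousAt.2 fun s => (hd s).continuousAt
  set w : ℝ → ℝ := fun s => 1 + |R - s| with hw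
  have hwc : Continuous w := by fun_prop
  have hwp : ∀ s, 0 < w s := fun s => by positivity
  have hw0 : ∀ s, w s ≠ 0 := fun s => (hwp s).ne'
  set D : ℝ → ℝ := fun s => 2 * h s * h' s * s / w s + h s ^ 2 / w s + h s ^ 2 * s / w s ^ 2 with hD
  have hDc : Continuous D := by
    have h2 : ∀ s, w s ^ 2 ≠ 0 := fun s => pow_ne_zero _ (hw0 s)
    fun_prop (disch := assumption)
  have hws : ∀ s ∈ Set.Icc 0 R, w s = 1 + R - s := fun s hs => by
    simp only [hw]; rw [abs_of_nonneg (by linarith [hs.2])]; ring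
  have e : ∫ s in (0 : ℝ)..R, D s = 0 := by
    rw [intervalIntegral.integral_eq_sub_of_hasDerivAt (f := fun s => h s ^ 2 * s / (1 + R - s))]
    · simp [h0]
    · intro s hs
      rw [Set.uIcc_of_le hR] at hs
      have hp : (1 + R - s) ≠ 0 := by linarith [hs.2]
      have := (((hd s).pow 2).mul (hasDerivAt_id s)).div
        ((hasDerivAt_id s).const_sub (1 + R)) hp
      refine this.congr_deriv ?_
      simp only [hD, hws s hs, Pi.pow_apply, Pi.mul_apply, id]
      field_simp
      push_cast
      ring
    · exact hDc.intervalIntegrable _ _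
  have hc2 : Continuous fun s => 2 * D s + 4 * (s * h' s ^ 2) := by fun_prop
  calc ∫ s in (0 : ℝ)..R, s * (h s ^ 2 / (1 + |R - s|) ^ 2)
      ≤ ∫ s in (0 : ℝ)..R, (2 * D s + 4 * (s * h' s ^ 2)) := by
        refine intervalIntegral.integral_mono_on hR ?_ (hc2.intervalIntegrable _ _) ?_
        · have h2 : ∀ s, (1 + |R - s|) ^ 2 ≠ 0 := fun s => pow_ne_zero _ (hw0 s)
          exact (by fun_prop (disch := assumption) :
            Continuous fun s => s * (h s ^ 2 / (1 + |R - s|) ^ 2)).intervalIntegrable _ _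
        · intro s hs
          change s * (h s ^ 2 / w s ^ 2) ≤ _
          have : 2 * D s + 4 * (s * h' s ^ 2) - s * (h s ^ 2 / w s ^ 2) =
              s * (h s / w s + 2 * h' s) ^ 2 + 2 * (h s ^ 2 / w s) := by
            have := hw0 s
            simp only [hD]
            field_simp
            ring
          have h3 : 0 ≤ s * (h s / w s + 2 * h' s) ^ 2 := mul_nonneg hs.1 (sq_nonneg _)
          have h4 : 0 ≤ h s ^ 2 / w s := div_nonneg (sq_nonneg _) (hwp s).le
          linarith
    _ = 4 * ∫ s in (0 : ℝ)..R, s * h' s ^ 2 := by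
        rw [intervalIntegral.integral_add ((hDc.const_mul 2).intervalIntegrable _ _)
          ((by fun_prop : Continuous fun s => 4 * (s * h' s ^ 2)).intervalIntegrable _ _),
          intervalIntegral.integral_const_mul, intervalIntegral.integral_const_mul, e]
        ring

theorem integral_eq_polar {g : ℝ × ℝ → ℝ} (hg : Continuous g) {R M : ℝ} (hR : 0 ≤ R)
    (hRM : R ≤ M) (h0 : ∀ p : ℝ × ℝ, R ≤ √(p.1 ^ 2 + p.2 ^ 2) → g p = 0) :
    ∫ p, g p = ∫ θ in (-π)..π, ∫ ρ in (0 : ℝ)..M, ρ * g (ρ * cos θ, ρ * sin θ) := by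
  have hc : Continuous fun p : ℝ × ℝ => p.1 * g (p.1 * cos p.2, p.1 * sin p.2) := by fun_prop
  have hint : IntegrableOn (fun p : ℝ × ℝ => p.1 * g (p.1 * cos p.2, p.1 * sin p.2))
      (Set.Ioc 0 M ×ˢ Set.Ioc (-π) π) :=
    (hc.continuousOn.integrableOn_compact (isCompact_Icc.prod isCompact_Icc)).mono_set
      (Set.prod_mono Set.Ioc_subset_Icc_self Set.Ioc_subset_Icc_self)
  rw [← integral_comp_polarCoord_symm]
  change ∫ p in Set.Ioi 0 ×ˢ Set.Ioo (-π) π, p.1 * g (p.1 * cos p.2, p.1 * sin p.2) = _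
  rw [← intervalIntegral_intervalIntegral_swap (F := fun ρ θ => ρ * g (ρ * cos θ, ρ * sin θ))]
  · rw [setIntegral_eq_of_subset_of_forall_sdiff_eq_zero (s := Set.Ioc 0 M ×ˢ Set.Ioo (-π) π)
      (measurableSet_Ioi.prod measurableSet_Ioo) (Set.prod_mono Set.Ioc_subset_Ioi_self le_rfl),
      Measure.volume_eq_prod, setIntegral_prod]
    · rw [intervalIntegral.integral_of_le (hR.trans hRM)]
      congr 1
      ext ρ
      rw [intervalIntegral.integral_of_le (by linarith [pi_pos]), integral_Ioc_eq_integral_Ioo]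
    · exact hint.mono_set (Set.prod_mono le_rfl Set.Ioo_subset_Ioc_self)
    · rintro ⟨ρ, θ⟩ ⟨⟨h1, h2⟩, h3⟩
      simp only [Set.mem_prod, Set.mem_Ioc, not_and, Set.mem_Ioi] at h1 h2 h3
      have h4 : M < ρ := by
        by_contra hcon
        exact h3 ⟨h1, not_lt.1 hcon⟩ h2
      rw [h0, mul_zero]
      have : (ρ * cos θ) ^ 2 + (ρ * sin θ) ^ 2 = ρ ^ 2 := by
        linear_combination ρ ^ 2 * cos_sq_add_sin_sq θ
      simp only [this, Real.sqrt_sq h1.le]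
      linarith
  · rw [Set.uIoc_of_le (hR.trans hRM), Set.uIoc_of_le (by linarith [pi_pos])]
    exact hint

theorem integral_box_le {g : ℝ × ℝ → ℝ} (hg : Integrable g) (h0 : ∀ p, 0 ≤ g p) {a b c d : ℝ}
    (hab : a ≤ b) (hcd : c ≤ d) :
    ∫ x in a..b, ∫ y in c..d, g (x, y) ≤ ∫ p, g p := by
  rw [intervalIntegral.integral_of_le hab]
  simp_rw [intervalIntegral.integral_of_le hcd]
  rw [← setIntegral_prod _ (hg.integrableOn), ← Measure.volume_eq_prod]
  exact setIntegral_le_integral hg (Filter.Eventually.of_forall h0)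

theorem integrable_of_zero_outside {g : ℝ × ℝ → ℝ} (hg : Continuous g) {R : ℝ}
    (h0 : ∀ p : ℝ × ℝ, R ≤ √(p.1 ^ 2 + p.2 ^ 2) → g p = 0) : Integrable g := by
  refine hg.integrable_of_hasCompactSupport
    (HasCompactSupport.intro (isCompact_closedBall (0 : ℝ × ℝ) R) fun p hp => h0 p ?_)
  rw [mem_closedBall_zero_iff, not_le] at hp
  refine hp.le.trans (max_le ?_ ?_) <;> refine Real.le_sqrt_of_sq_le ?_ <;>
    rw [Real.norm_eq_abs, sq_abs] <;> nlinarith [sq_nonneg p.1, sq_nonneg p.2]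

/-- The spacetime point with coordinates `t`, `a`, `b`. -/
def pt (t a b : ℝ) : Spt := ![t, a, b]

/-- The squared spatial gradient of `v` on the slice at time `t`. -/
def gradSq (t : ℝ) (v : Spt → ℝ) (p : ℝ × ℝ) : ℝ :=
  pd 1 v (pt t p.1 p.2) ^ 2 + pd 2 v (pt t p.1 p.2) ^ 2

/-- The squared spatial gradient of `v` plus `v ^ 2` with the Hardy weight. -/
def hardyDensity (t : ℝ) (v : Spt → ℝ) (p : ℝ × ℝ) : ℝ :=
  v (pt t p.1 p.2) ^ 2 / (1 + |1 + t - √(p.1 ^ 2 + p.2 ^ 2)|) ^ 2 + gradSq t v p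

/-- `v` vanishes on the closed exterior `1 + t ≤ |x|`, `0 ≤ t` of the light cone. -/
def VanishesOutsideCone (v : Spt → ℝ) : Prop :=
  ∀ y : Spt, 0 ≤ y 0 → 1 + y 0 ≤ rad y → v y = 0

theorem rad_pt (t a b : ℝ) : rad (pt t a b) = √(a ^ 2 + b ^ 2) := rfl

@[fun_prop]
theorem continuous_pt {X : Type*} [TopologicalSpace X] {f g h : X → ℝ} (hf : Continuous f)
    (hg : Continuous g) (hh : Continuous h) : Continuous fun x => pt (f x) (g x) (h x) := by
  refine continuous_pi fun i => ?_
  fin_cases i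
  exacts [hf, hg, hh]

theorem contDiff_pd {v : Spt → ℝ} (hv : ContDiff ℝ (⊤ : ℕ∞) v) (i : Fin 3) :
    ContDiff ℝ (⊤ : ℕ∞) (pd i v) :=
  (hv.fderiv_right (m := (⊤ : ℕ∞)) (by simp)).clm_apply contDiff_const

theorem contDiff_rotation {v : Spt → ℝ} (hv : ContDiff ℝ (⊤ : ℕ∞) v) :
    ContDiff ℝ (⊤ : ℕ∞) (Gam 3 v) :=
  ((contDiff_apply ℝ ℝ (1 : Fin 3)).mul (contDiff_pd hv 2)).sub
    ((contDiff_apply ℝ ℝ (2 : Fin 3)).mul (contDiff_pd hv 1))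

theorem continuous_gradSq {v : Spt → ℝ} (hv : ContDiff ℝ (⊤ : ℕ∞) v) (t : ℝ) :
    Continuous (gradSq t v) := by
  have h1 := (contDiff_pd hv 1).continuous
  have h2 := (contDiff_pd hv 2).continuous
  unfold gradSq
  fun_prop

theorem continuous_weighted_sq {v : Spt → ℝ} (hv : Continuous v) (t : ℝ) :
    Continuous fun p : ℝ × ℝ =>
      v (pt t p.1 p.2) ^ 2 / (1 + |1 + t - √(p.1 ^ 2 + p.2 ^ 2)|) ^ 2 := by
  have : ∀ p : ℝ × ℝ, (1 + |1 + t - √(p.1 ^ 2 + p.2 ^ 2)|) ^ 2 ≠ 0 := fun p => by positivity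
  fun_prop (disch := assumption)

theorem continuous_hardyDensity {v : Spt → ℝ} (hv : ContDiff ℝ (⊤ : ℕ∞) v) (t : ℝ) :
    Continuous (hardyDensity t v) :=
  (continuous_weighted_sq hv.continuous t).add (continuous_gradSq hv t)

theorem gradSq_nonneg (t : ℝ) (v : Spt → ℝ) (p : ℝ × ℝ) : 0 ≤ gradSq t v p := by
  unfold gradSq; positivity

theorem hardyDensity_nonneg (t : ℝ) (v : Spt → ℝ) (p : ℝ × ℝ) : 0 ≤ hardyDensity t v p :=
  add_nonneg (by positivity) (gradSq_nonneg t v p)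

theorem hasDerivAt_comp_pt {v : Spt → ℝ} (hv : ContDiff ℝ (⊤ : ℕ∞) v) (t : ℝ) {a b : ℝ → ℝ}
    {a' b' s : ℝ} (ha : HasDerivAt a a' s) (hb : HasDerivAt b b' s) :
    HasDerivAt (fun s => v (pt t (a s) (b s)))
      (a' * pd 1 v (pt t (a s) (b s)) + b' * pd 2 v (pt t (a s) (b s))) s := by
  have hc : HasDerivAt (fun s => pt t (a s) (b s)) (pt 0 a' b') s := by
    refine hasDerivAt_pi.2 fun i => ?_
    fin_cases i
    exacts [hasDerivAt_const s t, ha, hb]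
  have hf := (hv.differentiable (by simp) (pt t (a s) (b s))).hasFDerivAt.comp_hasDerivAt s hc
  refine hf.congr_deriv ?_
  have : pt 0 a' b' = a' • (Pi.single 1 1 : Spt) + b' • (Pi.single 2 1 : Spt) := by
    ext i
    fin_cases i <;> simp [pt]
  rw [this, map_add, map_smul, map_smul]
  rfl

theorem VanishesOutsideCone.of_interior {v : Spt → ℝ} (hv : Continuous v)
    (h : ∀ y : Spt, 0 < y 0 → 1 + y 0 < rad y → v y = 0) : VanishesOutsideCone v := by
  intro y h0 hy
  set c : ℝ → Spt := fun ε => pt (y 0 + ε) ((1 + 2 * ε) * y 1) ((1 + 2 * ε) * y 2) with hc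
  have hcc : Continuous c := by fun_prop
  have hc0 : c 0 = y := by
    ext i
    fin_cases i <;> simp [hc, pt]
  have hlim : Filter.Tendsto (fun ε => v (c ε)) (nhdsWithin 0 (Set.Ioi 0)) (nhds (v y)) := by
    have := (hv.comp hcc).tendsto 0
    simp only [Function.comp_def, hc0] at this
    exact this.mono_left nhdsWithin_le_nhds
  refine tendsto_nhds_unique hlim (tendsto_const_nhds.congr' ?_)
  filter_upwards [self_mem_nhdsWithin] with ε hε
  have hε : 0 < ε := hε
  refine (h _ (show 0 < y 0 + ε by linarith) ?_).symm
  have hr : rad (c ε) = (1 + 2 * ε) * rad y := by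
    rw [hc, rad_pt, rad, show ((1 + 2 * ε) * y 1) ^ 2 + ((1 + 2 * ε) * y 2) ^ 2 =
      (1 + 2 * ε) ^ 2 * (y 1 ^ 2 + y 2 ^ 2) by ring, Real.sqrt_mul (sq_nonneg _),
      Real.sqrt_sq (by linarith)]
  rw [hr]
  change 1 + (y 0 + ε) < _
  nlinarith

theorem VanishesOutsideCone.pd {v : Spt → ℝ} (hv : ContDiff ℝ (⊤ : ℕ∞) v)
    (h : VanishesOutsideCone v) (i : Fin 3) : VanishesOutsideCone (pd i v) := by
  refine .of_interior (contDiff_pd hv i).continuous fun y h0 hy => ?_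
  have hrad : Continuous rad := by unfold rad; fun_prop
  have ev : v =ᶠ[nhds y] fun _ => 0 := by
    have o1 : IsOpen {z : Spt | 0 < z 0} := isOpen_lt continuous_const (continuous_apply 0)
    have o2 : IsOpen {z : Spt | 1 + z 0 < rad z} :=
      isOpen_lt (continuous_const.add (continuous_apply 0)) hrad
    filter_upwards [o1.mem_nhds h0, o2.mem_nhds hy] with z h1 h2
    exact h z (le_of_lt h1) (le_of_lt h2)
  simp [_root_.pd, ev.fderiv_eq]

theorem VanishesOutsideCone.rotation {v : Spt → ℝ} (hv : ContDiff ℝ (⊤ : ℕ∞) v)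
    (h : VanishesOutsideCone v) : VanishesOutsideCone (Gam 3 v) := by
  intro y h0 hy
  change y 1 * _root_.pd 2 v y - y 2 * _root_.pd 1 v y = 0
  rw [h.pd hv 1 y h0 hy, h.pd hv 2 y h0 hy]
  simp

section Slice

variable {t : ℝ} {v : Spt → ℝ}

theorem VanishesOutsideCone.apply_pt (h : VanishesOutsideCone v) (ht : 0 ≤ t) {a b : ℝ}
    (hab : 1 + t ≤ √(a ^ 2 + b ^ 2)) : v (pt t a b) = 0 :=
  h _ ht (by rwa [rad_pt])

theorem VanishesOutsideCone.gradSq_eq_zero (hv : ContDiff ℝ (⊤ : ℕ∞) v)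
    (h : VanishesOutsideCone v) (ht : 0 ≤ t) (p : ℝ × ℝ) (hp : 1 + t ≤ √(p.1 ^ 2 + p.2 ^ 2)) :
    gradSq t v p = 0 := by
  simp [gradSq, (h.pd hv 1).apply_pt ht hp, (h.pd hv 2).apply_pt ht hp]

theorem VanishesOutsideCone.hardyDensity_eq_zero (hv : ContDiff ℝ (⊤ : ℕ∞) v)
    (h : VanishesOutsideCone v) (ht : 0 ≤ t) (p : ℝ × ℝ) (hp : 1 + t ≤ √(p.1 ^ 2 + p.2 ^ 2)) :
    hardyDensity t v p = 0 := by
  simp [hardyDensity, h.gradSq_eq_zero hv ht p hp, h.apply_pt ht hp]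

theorem sqrt_polar {ρ : ℝ} (hρ : 0 ≤ ρ) (θ : ℝ) : √((ρ * cos θ) ^ 2 + (ρ * sin θ) ^ 2) = ρ := by
  rw [show (ρ * cos θ) ^ 2 + (ρ * sin θ) ^ 2 = ρ ^ 2 by
    linear_combination ρ ^ 2 * cos_sq_add_sin_sq θ, Real.sqrt_sq hρ]

theorem hasDerivAt_radial (hv : ContDiff ℝ (⊤ : ℕ∞) v) (t θ ρ : ℝ) :
    HasDerivAt (fun ρ => v (pt t (ρ * cos θ) (ρ * sin θ)))
      (cos θ * pd 1 v (pt t (ρ * cos θ) (ρ * sin θ)) +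
        sin θ * pd 2 v (pt t (ρ * cos θ) (ρ * sin θ))) ρ :=
  hasDerivAt_comp_pt hv t (hasDerivAt_mul_const _) (hasDerivAt_mul_const _)

theorem sq_radial_le_gradSq (θ ρ : ℝ) :
    (cos θ * pd 1 v (pt t (ρ * cos θ) (ρ * sin θ)) +
      sin θ * pd 2 v (pt t (ρ * cos θ) (ρ * sin θ))) ^ 2 ≤
      gradSq t v (ρ * cos θ, ρ * sin θ) := by
  simp only [gradSq]
  generalize pd 1 v _ = a
  generalize pd 2 v _ = b
  have : (cos θ * a + sin θ * b) ^ 2 + (sin θ * a - cos θ * b) ^ 2 = a ^ 2 + b ^ 2 := by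
    linear_combination (a ^ 2 + b ^ 2) * cos_sq_add_sin_sq θ
  nlinarith [sq_nonneg (sin θ * a - cos θ * b)]

/-- Hardy inequality with the weight `⟨|x| - t⟩⁻¹`, for functions supported in `|x| ≤ 1 + t`. -/
theorem integral_hardyDensity_le (hv : ContDiff ℝ (⊤ : ℕ∞) v) (h : VanishesOutsideCone v)
    (ht : 0 ≤ t) : ∫ p, hardyDensity t v p ≤ 5 * ∫ p, gradSq t v p := by
  have hR : 0 ≤ 1 + t := by linarith
  have hgc := continuous_gradSq hv t
  have hwc := continuous_weighted_sq hv.continuous t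
  have hw0 : ∀ p : ℝ × ℝ, 1 + t ≤ √(p.1 ^ 2 + p.2 ^ 2) →
      v (pt t p.1 p.2) ^ 2 / (1 + |1 + t - √(p.1 ^ 2 + p.2 ^ 2)|) ^ 2 = 0 := fun p hp => by
    simp [h.apply_pt ht hp]
  have e : ∫ p, hardyDensity t v p =
      (∫ p : ℝ × ℝ, v (pt t p.1 p.2) ^ 2 / (1 + |1 + t - √(p.1 ^ 2 + p.2 ^ 2)|) ^ 2) +
        ∫ p, gradSq t v p :=
    integral_add (integrable_of_zero_outside hwc hw0)
      (integrable_of_zero_outside hgc (h.gradSq_eq_zero hv ht))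
  have hh : (∫ p : ℝ × ℝ, v (pt t p.1 p.2) ^ 2 / (1 + |1 + t - √(p.1 ^ 2 + p.2 ^ 2)|) ^ 2) ≤
      4 * ∫ p, gradSq t v p := by
    rw [integral_eq_polar hwc hR le_rfl hw0,
      integral_eq_polar hgc hR le_rfl (h.gradSq_eq_zero hv ht),
      ← intervalIntegral.integral_const_mul]
    refine intervalIntegral.integral_mono_on (by linarith [pi_pos]) ?_ ?_ fun θ _ => ?_
    · refine Continuous.intervalIntegrable ?_ _ _
      refine intervalIntegral.continuous_parametric_intervalIntegral_of_continuous' ?_ _ _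
      have := hwc.comp (by fun_prop : Continuous fun q : ℝ × ℝ => (q.2 * cos q.1, q.2 * sin q.1))
      exact continuous_snd.mul this
    · refine Continuous.intervalIntegrable ?_ _ _
      refine (intervalIntegral.continuous_parametric_intervalIntegral_of_continuous' ?_ _ _).const_mul 4
      have := hgc.comp (by fun_prop : Continuous fun q : ℝ × ℝ => (q.2 * cos q.1, q.2 * sin q.1))
      exact continuous_snd.mul this
    · have h1 := (contDiff_pd hv 1).continuous
      have h2 := (contDiff_pd hv 2).continuous
      have key := integral_radial_hardy (hasDerivAt_radial hv t θ) (by fun_prop) hR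
        (h.apply_pt ht (sqrt_polar hR θ).ge)
      refine le_trans (le_of_eq ?_) (key.trans ?_)
      · refine intervalIntegral.integral_congr fun ρ hρ => ?_
        rw [Set.uIcc_of_le hR] at hρ
        simp only [sqrt_polar hρ.1]
      · refine mul_le_mul_of_nonneg_left ?_ (by norm_num)
        refine intervalIntegral.integral_mono_on hR
          (Continuous.intervalIntegrable (by fun_prop) _ _)
          (Continuous.intervalIntegrable (by fun_prop) _ _) fun ρ hρ => ?_
        exact mul_le_mul_of_nonneg_left (sq_radial_le_gradSq θ ρ) hρ.1
  linarith

theorem sq_add_le_weighted {r ρ a A : ℝ} (hρ : |ρ - r| ≤ 2) (hA : 0 ≤ A) :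
    a ^ 2 + A ≤ 17 * (1 + (r - t) ^ 2) * (a ^ 2 / (1 + |1 + t - ρ|) ^ 2 + A) := by
  have h1 : 1 + |1 + t - ρ| ≤ 4 + |r - t| := by
    have := abs_sub_le_iff.1 hρ
    have h2 : |1 + t - ρ| ≤ 3 + |r - t| := by
      rw [abs_le]
      constructor <;> linarith [le_abs_self (r - t), neg_abs_le (r - t)]
    linarith
  have hw : (1 + |1 + t - ρ|) ^ 2 ≤ 17 * (1 + (r - t) ^ 2) := by
    have : (1 + |1 + t - ρ|) ^ 2 ≤ (4 + |r - t|) ^ 2 := by gcongr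
    nlinarith [sq_nonneg (4 * |r - t| - 1), sq_abs (r - t)]
  have hp : 0 < (1 + |1 + t - ρ|) ^ 2 := by positivity
  have e : a ^ 2 ≤ 17 * (1 + (r - t) ^ 2) * (a ^ 2 / (1 + |1 + t - ρ|) ^ 2) := by
    rw [mul_div_assoc', le_div_iff₀ hp, mul_comm]
    gcongr
  nlinarith [mul_nonneg (sq_nonneg (r - t)) hA]

end Slice

section Pointwise

variable {t : ℝ} {v : Spt → ℝ}

theorem sq_le_integral_vertical (hv : ContDiff ℝ (⊤ : ℕ∞) v) {r s b : ℝ}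
    (hr : r ∈ Set.Icc (0 : ℝ) 1) (hs : s ∈ Set.Icc (-1 : ℝ) 1) (hb : b ∈ Set.Icc (-1 : ℝ) 1) :
    v (pt t s b) ^ 2 ≤
      34 * (1 + (r - t) ^ 2) * ∫ y in (-1 : ℝ)..1, hardyDensity t v (s, y) := by
  have hd : ∀ y, HasDerivAt (fun y => v (pt t s y)) (pd 2 v (pt t s y)) y := fun y =>
    (hasDerivAt_comp_pt hv t (hasDerivAt_const y s) (hasDerivAt_id y)).congr_deriv (by simp)
  have h0 := hv.continuous
  have h2 := (contDiff_pd hv 2).continuous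
  have hG := continuous_hardyDensity hv t
  have key := sq_le_two_mul_integral hd (by fun_prop) (by norm_num) hb
  have mono : ∫ y in (-1 : ℝ)..1, (v (pt t s y) ^ 2 + pd 2 v (pt t s y) ^ 2) ≤
      ∫ y in (-1 : ℝ)..1, 17 * (1 + (r - t) ^ 2) * hardyDensity t v (s, y) := by
    refine intervalIntegral.integral_mono_on (by norm_num)
      (Continuous.intervalIntegrable (by fun_prop) _ _)
      (Continuous.intervalIntegrable (by fun_prop) _ _) fun y hy => ?_
    have hρ : |√(s ^ 2 + y ^ 2) - r| ≤ 2 := by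
      have : √(s ^ 2 + y ^ 2) ≤ 2 :=
        Real.sqrt_le_iff.2 ⟨by norm_num, by nlinarith [hs.1, hs.2, hy.1, hy.2]⟩
      rw [abs_le]
      constructor <;> linarith [hr.1, hr.2, Real.sqrt_nonneg (s ^ 2 + y ^ 2)]
    refine le_trans ?_ (sq_add_le_weighted (t := t) hρ (gradSq_nonneg t v (s, y)))
    simp only [gradSq]
    linarith [sq_nonneg (pd 1 v (pt t s y))]
  rw [intervalIntegral.integral_const_mul] at mono
  linarith

theorem mul_sq_le_integral_radial (hv : ContDiff ℝ (⊤ : ℕ∞) v) {r M : ℝ} (hr : 0 ≤ r)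
    (hM : r + 1 ≤ M) (θ : ℝ) :
    r * v (pt t (r * cos θ) (r * sin θ)) ^ 2 ≤
      34 * (1 + (r - t) ^ 2) *
        ∫ ρ in (0 : ℝ)..M, ρ * hardyDensity t v (ρ * cos θ, ρ * sin θ) := by
  have h0 := hv.continuous
  have h1 := (contDiff_pd hv 1).continuous
  have h2 := (contDiff_pd hv 2).continuous
  have hG := continuous_hardyDensity hv t
  have key := sq_le_two_mul_integral (hasDerivAt_radial hv t θ) (by fun_prop) le_rfl
    (Set.left_mem_Icc.2 (by linarith : r ≤ r + 1))
  have mono : r * ∫ ρ in r..(r + 1), (v (pt t (ρ * cos θ) (ρ * sin θ)) ^ 2 +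
        (cos θ * pd 1 v (pt t (ρ * cos θ) (ρ * sin θ)) +
          sin θ * pd 2 v (pt t (ρ * cos θ) (ρ * sin θ))) ^ 2) ≤
      17 * (1 + (r - t) ^ 2) *
        ∫ ρ in r..(r + 1), ρ * hardyDensity t v (ρ * cos θ, ρ * sin θ) := by
    rw [← intervalIntegral.integral_const_mul, ← intervalIntegral.integral_const_mul]
    refine intervalIntegral.integral_mono_on (by linarith)
      (Continuous.intervalIntegrable (by fun_prop) _ _)
      (Continuous.intervalIntegrable (by fun_prop) _ _) fun ρ hρ => ?_
    have hρ0 : 0 ≤ ρ := hr.trans hρ.1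
    have hρr : |ρ - r| ≤ 2 := by
      rw [abs_le]
      constructor <;> linarith [hρ.1, hρ.2]
    have hw := sq_add_le_weighted (t := t) (a := v (pt t (ρ * cos θ) (ρ * sin θ))) hρr
      (gradSq_nonneg t v (ρ * cos θ, ρ * sin θ))
    have hrad := sq_radial_le_gradSq (t := t) (v := v) θ ρ
    rw [hardyDensity, sqrt_polar hρ0, mul_left_comm]
    refine mul_le_mul hρ.1 (le_trans ?_ hw) (by positivity) hρ0
    linarith
  have ext : ∫ ρ in r..(r + 1), ρ * hardyDensity t v (ρ * cos θ, ρ * sin θ) ≤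
      ∫ ρ in (0 : ℝ)..M, ρ * hardyDensity t v (ρ * cos θ, ρ * sin θ) := by
    refine intervalIntegral.integral_mono_interval hr (by linarith) hM ?_
      (Continuous.intervalIntegrable (by fun_prop) _ _)
    filter_upwards [self_mem_ae_restrict measurableSet_Ioc] with ρ hρ
    exact mul_nonneg hρ.1.le (hardyDensity_nonneg t v _)
  have h3 := mul_le_mul_of_nonneg_left key hr
  have h4 := mul_le_mul_of_nonneg_left ext
    (by positivity : (0 : ℝ) ≤ 17 * (1 + (r - t) ^ 2))
  linarith

theorem sq_le_near_origin (hv : ContDiff ℝ (⊤ : ℕ∞) v) (h : VanishesOutsideCone v)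
    (ht : 0 ≤ t) {a b : ℝ} (hab : √(a ^ 2 + b ^ 2) ≤ 1) :
    v (pt t a b) ^ 2 ≤ 68 * (1 + (√(a ^ 2 + b ^ 2) - t) ^ 2) *
      ((∫ p, hardyDensity t v p) + ∫ p, hardyDensity t (pd 1 v) p) := by
  have hr : √(a ^ 2 + b ^ 2) ∈ Set.Icc (0 : ℝ) 1 := ⟨Real.sqrt_nonneg _, hab⟩
  have hle : a ^ 2 + b ^ 2 ≤ 1 := by simpa using (Real.sqrt_le_iff.1 hab).2
  have ha : a ∈ Set.Icc (-1 : ℝ) 1 := abs_le.1 (abs_le_one_iff_mul_self_le_one.2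
    (by nlinarith [sq_nonneg b]))
  have hb : b ∈ Set.Icc (-1 : ℝ) 1 := abs_le.1 (abs_le_one_iff_mul_self_le_one.2
    (by nlinarith [sq_nonneg a]))
  have hv1 := contDiff_pd hv 1
  have h0 := hv.continuous
  have h1 := hv1.continuous
  have hG := continuous_hardyDensity hv t
  have hG1 := continuous_hardyDensity hv1 t
  have hd : ∀ s, HasDerivAt (fun s => v (pt t s b)) (pd 1 v (pt t s b)) s := fun s =>
    (hasDerivAt_comp_pt hv t (hasDerivAt_id s) (hasDerivAt_const s b)).congr_deriv (by simp)
  have key := sq_le_two_mul_integral hd (by fun_prop) (by norm_num) ha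
  set K := 34 * (1 + (√(a ^ 2 + b ^ 2) - t) ^ 2) with hK
  have hK0 : 0 ≤ K := by positivity
  have c0 : Continuous fun s => ∫ y in (-1 : ℝ)..1, hardyDensity t v (s, y) :=
    intervalIntegral.continuous_parametric_intervalIntegral_of_continuous'
      (f := fun s y => hardyDensity t v (s, y)) hG _ _
  have c1 : Continuous fun s => ∫ y in (-1 : ℝ)..1, hardyDensity t (pd 1 v) (s, y) :=
    intervalIntegral.continuous_parametric_intervalIntegral_of_continuous'
      (f := fun s y => hardyDensity t (pd 1 v) (s, y)) hG1 _ _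
  have mono : ∫ s in (-1 : ℝ)..1, (v (pt t s b) ^ 2 + pd 1 v (pt t s b) ^ 2) ≤
      ∫ s in (-1 : ℝ)..1, (K * (∫ y in (-1 : ℝ)..1, hardyDensity t v (s, y)) +
        K * ∫ y in (-1 : ℝ)..1, hardyDensity t (pd 1 v) (s, y)) :=
    intervalIntegral.integral_mono_on (by norm_num)
      (Continuous.intervalIntegrable (by fun_prop) _ _)
      (((c0.const_mul K).add (c1.const_mul K)).intervalIntegrable _ _) fun s hs =>
      add_le_add (sq_le_integral_vertical hv hr hs hb) (sq_le_integral_vertical hv1 hr hs hb)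
  rw [intervalIntegral.integral_add ((c0.const_mul K).intervalIntegrable _ _)
    ((c1.const_mul K).intervalIntegrable _ _), intervalIntegral.integral_const_mul,
    intervalIntegral.integral_const_mul] at mono
  have e0 := mul_le_mul_of_nonneg_left (integral_box_le
    (integrable_of_zero_outside hG (h.hardyDensity_eq_zero hv ht)) (hardyDensity_nonneg t v)
    (by norm_num : (-1 : ℝ) ≤ 1) (by norm_num : (-1 : ℝ) ≤ 1)) hK0
  have e1 := mul_le_mul_of_nonneg_left (integral_box_le
    (integrable_of_zero_outside hG1 ((h.pd hv 1).hardyDensity_eq_zero hv1 ht))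
    (hardyDensity_nonneg t (pd 1 v))
    (by norm_num : (-1 : ℝ) ≤ 1) (by norm_num : (-1 : ℝ) ≤ 1)) hK0
  linarith

theorem mul_sq_le_inside_cone (hv : ContDiff ℝ (⊤ : ℕ∞) v) (h : VanishesOutsideCone v)
    (ht : 0 ≤ t) {r θ : ℝ} (hr : 0 ≤ r) (hrt : r ≤ 1 + t) (hθ : θ ∈ Set.Icc (-π) π) :
    r * v (pt t (r * cos θ) (r * sin θ)) ^ 2 ≤ 68 * (1 + (r - t) ^ 2) *
      ((∫ p, hardyDensity t v p) + ∫ p, hardyDensity t (Gam 3 v) p) := by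
  have hvr := contDiff_rotation hv
  have h0 := hv.continuous
  have h1 := hvr.continuous
  have hG := continuous_hardyDensity hv t
  have hG1 := continuous_hardyDensity hvr t
  have hd : ∀ s, HasDerivAt (fun s => v (pt t (r * cos s) (r * sin s)))
      (Gam 3 v (pt t (r * cos s) (r * sin s))) s := fun s => by
    refine (hasDerivAt_comp_pt hv t ((hasDerivAt_cos s).const_mul r)
      ((hasDerivAt_sin s).const_mul r)).congr_deriv ?_
    simp only [Gam, pt, Matrix.cons_val]
    ring
  have key := mul_le_mul_of_nonneg_left
    (sq_le_two_mul_integral hd (by fun_prop) (by linarith [pi_gt_three]) hθ) hr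
  set K := 34 * (1 + (r - t) ^ 2) with hK
  have hM : r + 1 ≤ 2 + t := by linarith
  have hR : 0 ≤ 1 + t := by linarith
  have hRM : 1 + t ≤ 2 + t := by linarith
  have c0 : Continuous fun θ =>
      ∫ ρ in (0 : ℝ)..(2 + t), ρ * hardyDensity t v (ρ * cos θ, ρ * sin θ) :=
    intervalIntegral.continuous_parametric_intervalIntegral_of_continuous'
      (by unfold Function.uncurry; fun_prop) _ _
  have c1 : Continuous fun θ =>
      ∫ ρ in (0 : ℝ)..(2 + t), ρ * hardyDensity t (Gam 3 v) (ρ * cos θ, ρ * sin θ) :=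
    intervalIntegral.continuous_parametric_intervalIntegral_of_continuous'
      (by unfold Function.uncurry; fun_prop) _ _
  have mono : r * ∫ s in (-π)..π, (v (pt t (r * cos s) (r * sin s)) ^ 2 +
        Gam 3 v (pt t (r * cos s) (r * sin s)) ^ 2) ≤
      ∫ θ in (-π)..π,
        (K * (∫ ρ in (0 : ℝ)..(2 + t), ρ * hardyDensity t v (ρ * cos θ, ρ * sin θ)) +
        K * ∫ ρ in (0 : ℝ)..(2 + t), ρ * hardyDensity t (Gam 3 v) (ρ * cos θ, ρ * sin θ)) := by
    rw [← intervalIntegral.integral_const_mul]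
    refine intervalIntegral.integral_mono_on (by linarith [pi_pos])
      (Continuous.intervalIntegrable (by fun_prop) _ _)
      (((c0.const_mul K).add (c1.const_mul K)).intervalIntegrable _ _) fun s _ => ?_
    rw [mul_add]
    exact add_le_add (mul_sq_le_integral_radial hv hr hM s)
      (mul_sq_le_integral_radial hvr hr hM s)
  rw [intervalIntegral.integral_add ((c0.const_mul K).intervalIntegrable _ _)
    ((c1.const_mul K).intervalIntegrable _ _), intervalIntegral.integral_const_mul,
    intervalIntegral.integral_const_mul,
    ← integral_eq_polar hG hR hRM (h.hardyDensity_eq_zero hv ht),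
    ← integral_eq_polar hG1 hR hRM ((h.rotation hv).hardyDensity_eq_zero hvr ht)] at mono
  linarith

end Pointwise

theorem integral_slice (t : ℝ) (F : Spt → ℝ) :
    ∫ x : Sp, F (st t x) = ∫ p : ℝ × ℝ, F (pt t p.1 p.2) :=
  (volume_preserving_finTwoArrow ℝ).integral_comp
    (MeasurableEquiv.finTwoArrow (α := ℝ)).measurableEmbedding
    fun p : ℝ × ℝ => F (pt t p.1 p.2)

theorem integral_gradSq_le_energy {u : Spt → ℝ} {t : ℝ} {J : ℕ} {α : Fin 5 → ℕ}
    (hα : α ∈ midx J) (hv : ContDiff ℝ (⊤ : ℕ∞) (GamPow α u))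
    (h : VanishesOutsideCone (GamPow α u)) (ht : 0 ≤ t) :
    ∫ p, gradSq t (GamPow α u) p ≤ energy J u t := by
  have hint : ∀ i, Integrable fun p : ℝ × ℝ => pd i (GamPow α u) (pt t p.1 p.2) ^ 2 := fun i => by
    have := (contDiff_pd hv i).continuous
    exact integrable_of_zero_outside (R := 1 + t) (by fun_prop) fun p hp => by
      simp [(h.pd hv i).apply_pt ht hp]
  have e : ∫ p, gradSq t (GamPow α u) p =
      (∫ x : Sp, pd 1 (GamPow α u) (st t x) ^ 2) + ∫ x : Sp, pd 2 (GamPow α u) (st t x) ^ 2 := by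
    rw [integral_slice t (fun y => pd 1 (GamPow α u) y ^ 2),
      integral_slice t (fun y => pd 2 (GamPow α u) y ^ 2)]
    exact integral_add (hint 1) (hint 2)
  have nn : ∀ (β : Fin 5 → ℕ) (i : Fin 3), 0 ≤ ∫ x : Sp, pd i (GamPow β u) (st t x) ^ 2 :=
    fun β i => integral_nonneg fun x => sq_nonneg _
  calc ∫ p, gradSq t (GamPow α u) p
      ≤ ∑ i : Fin 3, ∫ x : Sp, pd i (GamPow α u) (st t x) ^ 2 := by
        rw [e, Fin.sum_univ_three]
        linarith [nn α 0]
    _ ≤ energy J u t :=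
        Finset.single_le_sum (f := fun α => ∑ i : Fin 3, ∫ x : Sp, pd i (GamPow α u) (st t x) ^ 2)
          (fun β _ => Finset.sum_nonneg fun i _ => nn β i) hα

theorem zero_mem_midx (k : ℕ) : (0 : Fin 5 → ℕ) ∈ midx k := by
  simp [midx]

theorem single_mem_midx (j : Fin 5) : (Pi.single j 1 : Fin 5 → ℕ) ∈ midx 1 := by
  simp only [midx, Finset.mem_filter, Fintype.mem_piFinset, Finset.mem_range]
  refine ⟨fun i => ?_, ?_⟩
  · rcases eq_or_ne i j with rfl | hij
    · simp
    · simp [Pi.single_eq_of_ne hij]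
  · simp

theorem jb_mul_sq_le {u : Spt → ℝ} (hu : ContDiff ℝ (⊤ : ℕ∞) u) (h : VanishesOutsideCone u)
    {t : ℝ} (ht : 0 ≤ t) (x : Sp) :
    jb (nrm2 x) * u (st t x) ^ 2 ≤ 1600 * (1 + (nrm2 x - t) ^ 2) * energy 1 u t := by
  have hst : st t x = pt t (x 0) (x 1) := rfl
  have bound : ∀ α ∈ midx 1, ∀ v, GamPow α u = v → ContDiff ℝ (⊤ : ℕ∞) v →
      VanishesOutsideCone v → ∫ p, hardyDensity t v p ≤ 5 * energy 1 u t := by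
    rintro α hα _ rfl hv hvan
    have := integral_hardyDensity_le hv hvan ht
    have := integral_gradSq_le_energy hα hv hvan ht
    linarith
  have b0 := bound 0 (zero_mem_midx 1) u rfl hu h
  have b1 := bound (Pi.single 1 1) (single_mem_midx 1) (pd 1 u) rfl (contDiff_pd hu 1) (h.pd hu 1)
  have b3 := bound (Pi.single 3 1) (single_mem_midx 3) (Gam 3 u) rfl (contDiff_rotation hu)
    (h.rotation hu)
  have hE : 0 ≤ energy 1 u t := by
    have : 0 ≤ ∫ p, hardyDensity t u p := integral_nonneg (hardyDensity_nonneg t u)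
    linarith
  set r := nrm2 x with hr
  have hr0 : 0 ≤ r := Real.sqrt_nonneg _
  have hK : 0 ≤ 1 + (r - t) ^ 2 := by positivity
  rcases le_or_gt r 1 with h1 | h1
  · have key := sq_le_near_origin hu h ht (a := x 0) (b := x 1) h1
    have hj : jb r ≤ 2 := Real.sqrt_le_iff.2 ⟨by norm_num, by nlinarith⟩
    have hj' := mul_le_mul_of_nonneg_right hj (sq_nonneg (u (pt t (x 0) (x 1))))
    change _ ≤ 68 * (1 + (r - t) ^ 2) * _ at key
    have hs := mul_le_mul_of_nonneg_left (add_le_add b0 b1) hK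
    rw [hst]
    nlinarith [mul_nonneg hK hE]
  · have hj : jb r ≤ 2 * r := Real.sqrt_le_iff.2 ⟨by linarith, by nlinarith⟩
    have hj' := mul_le_mul_of_nonneg_right hj (sq_nonneg (u (pt t (x 0) (x 1))))
    rw [hst]
    rcases le_or_gt r (1 + t) with hrt | hrt
    · set z : ℂ := ⟨x 0, x 1⟩ with hz
      have hzr : ‖z‖ = r := by
        rw [hr, nrm2, Complex.norm_eq_sqrt_sq_add_sq]
      have hc : r * cos z.arg = x 0 := by rw [← hzr, Complex.norm_mul_cos_arg]
      have hs : r * sin z.arg = x 1 := by rw [← hzr, Complex.norm_mul_sin_arg]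
      have key := mul_sq_le_inside_cone hu h ht hr0 hrt
        ⟨(Complex.neg_pi_lt_arg z).le, Complex.arg_le_pi z⟩
      rw [hc, hs] at key
      have hs := mul_le_mul_of_nonneg_left (add_le_add b0 b3) hK
      nlinarith [mul_nonneg hK hE]
    · rw [h.apply_pt ht (show 1 + t ≤ √(x 0 ^ 2 + x 1 ^ 2) from hrt.le)]
      have := mul_nonneg hK hE
      nlinarith

/-- Weighted pointwise decay estimate: for u smooth and supported in {|x| ≤ 1 + t},
⟨|x|−t⟩⁻¹ |u(t,x)| ≤ C ⟨x⟩^{−1/2} ‖(∂Γ^{≤1}u)(t,·)‖_{L²(ℝ²)}, with C absolute. -/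
theorem statement3 :
    ∃ C > (0 : ℝ), ∀ u : Spt → ℝ, ContDiff ℝ (⊤ : ℕ∞) u →
      (∀ y : Spt, 0 ≤ y 0 → 1 + y 0 < rad y → u y = 0) →
      ∀ t : ℝ, 0 ≤ t → ∀ x : Sp,
        (jb (nrm2 x - t))⁻¹ * |u (st t x)| ≤
          C * (jb (nrm2 x)) ^ (-(1 : ℝ) / 2) * Real.sqrt (energy 1 u t) := by
  refine ⟨40, by norm_num, fun u hu hsupp t ht x => ?_⟩
  have h : VanishesOutsideCone u :=
    .of_interior hu.continuous fun y h0 hy => hsupp y h0.le hy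
  have key := jb_mul_sq_le hu h ht x
  have hE : 0 ≤ energy 1 u t :=
    Finset.sum_nonneg fun _ _ => Finset.sum_nonneg fun _ _ => integral_nonneg fun _ => sq_nonneg _
  have hj : 0 < jb (nrm2 x) := Real.sqrt_pos.2 (by positivity)
  have hw : 0 < jb (nrm2 x - t) := Real.sqrt_pos.2 (by positivity)
  have hw2 : jb (nrm2 x - t) ^ 2 = 1 + (nrm2 x - t) ^ 2 := Real.sq_sqrt (by positivity)
  have hpow : jb (nrm2 x) ^ (-(1 : ℝ) / 2) = (√(jb (nrm2 x)))⁻¹ := by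
    rw [neg_div, Real.rpow_neg hj.le, Real.sqrt_eq_rpow]
  have hs : 0 < √(jb (nrm2 x)) := Real.sqrt_pos.2 hj
  have main : √(jb (nrm2 x)) * |u (st t x)| ≤ 40 * jb (nrm2 x - t) * √(energy 1 u t) := by
    refine abs_le_of_sq_le_sq' ?_ (by positivity) |>.2
    rw [mul_pow, mul_pow, mul_pow, Real.sq_sqrt hj.le, Real.sq_sqrt hE, sq_abs, hw2]
    linarith
  rw [hpow, inv_mul_le_iff₀ hw]
  calc |u (st t x)| = (√(jb (nrm2 x)))⁻¹ * (√(jb (nrm2 x)) * |u (st t x)|) := by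
        field_simp
    _ ≤ (√(jb (nrm2 x)))⁻¹ * (40 * jb (nrm2 x - t) * √(energy 1 u t)) := by gcongr
    _ = _ := by ring
end
end

section
/- There is an absolute constant C > 0 such that for every f ∈ C_c^∞(ℝ²), every t ≥ 0 and every x₀ ∈ ℝ², ⟨|x₀| − t⟩^{1/2} |f(x₀)| ≤ C ( ‖f‖_{L²(ℝ²)} + ‖⟨|x| − t⟩ ∇f‖_{L²(ℝ²)} + ‖⟨|x| − t⟩ ∂_1∂_2 f‖_{L²(ℝ²)} ). -/
open MeasureTheory Real

noncomputable section

/-- One-dimensional Sobolev inequality on `[a, a + h]` at the left endpoint. -/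
lemma sq_left_endpoint_le {g g' : ℝ → ℝ} (hg : ∀ s, HasDerivAt g (g' s) s)
    (hg' : Continuous g') {h : ℝ} (hh : 0 < h) (a : ℝ) :
    g a ^ 2 ≤ ∫ s in a..a + h, (2 / h * g s ^ 2 + h * g' s ^ 2) := by
  have hgc : Continuous g := continuous_iff_continuousAt.2 fun s => (hg s).continuousAt
  have hderiv : ∀ s, HasDerivAt (fun s => (s - a - h) / h * g s ^ 2)
      (1 / h * g s ^ 2 + (s - a - h) / h * (2 * g s * g' s)) s := by
    intro s
    have h1 : HasDerivAt (fun s : ℝ => (s - a - h) / h) (1 / h) s :=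
      (((hasDerivAt_id s).sub_const a).sub_const h).div_const h
    have h2 := h1.mul ((hg s).pow 2)
    refine h2.congr_deriv ?_
    norm_num
  have hftc := intervalIntegral.integral_eq_sub_of_hasDerivAt (a := a) (b := a + h)
    (fun s _ => hderiv s) ((by fun_prop : Continuous fun s =>
      1 / h * g s ^ 2 + (s - a - h) / h * (2 * g s * g' s)).intervalIntegrable _ _)
  have hval : g a ^ 2 = ∫ s in a..a + h,
      (1 / h * g s ^ 2 + (s - a - h) / h * (2 * g s * g' s)) := by
    rw [hftc]
    field_simp
    ring
  rw [hval]
  refine intervalIntegral.integral_mono_on (by linarith)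
    ((by fun_prop : Continuous _).intervalIntegrable _ _)
    ((by fun_prop : Continuous _).intervalIntegrable _ _) fun s hs => ?_
  obtain ⟨c, hc⟩ : ∃ c, (s - a - h) / h = c := ⟨_, rfl⟩
  have hc0 : c ≤ 0 := hc ▸ div_nonpos_of_nonpos_of_nonneg (by linarith [hs.2]) hh.le
  have hc1 : -1 ≤ c := by rw [← hc, le_div_iff₀ hh]; linarith [hs.1]
  have hcc : c ^ 2 ≤ 1 := by nlinarith
  have hsq : 0 ≤ (c * g s - h * g' s) ^ 2 / h := by positivity
  have hexp : (c * g s - h * g' s) ^ 2 / h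
      = c ^ 2 * (g s ^ 2 / h) - c * (2 * g s * g' s) + h * g' s ^ 2 := by
    field_simp
    ring
  have hle : c ^ 2 * (g s ^ 2 / h) ≤ 1 * (g s ^ 2 / h) := by gcongr
  rw [hc]
  have e1 : 1 / h * g s ^ 2 = g s ^ 2 / h := by ring
  have e2 : 2 / h * g s ^ 2 = g s ^ 2 / h + g s ^ 2 / h := by ring
  linarith

lemma contDiff_spd {f : Sp → ℝ} (hf : ContDiff ℝ (⊤ : ℕ∞) f) (i : Fin 2) :
    ContDiff ℝ (⊤ : ℕ∞) (spd i f) :=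
  (hf.fderiv_right (m := (⊤ : ℕ∞)) (by simp)).clm_apply contDiff_const

lemma hasCompactSupport_spd {f : Sp → ℝ} (hf : HasCompactSupport f) (i : Fin 2) :
    HasCompactSupport (spd i f) :=
  hf.fderiv_apply ℝ (Pi.single i 1)

lemma hasDerivAt_spd_zero {f : Sp → ℝ} (hf : ContDiff ℝ (⊤ : ℕ∞) f) (y s : ℝ) :
    HasDerivAt (fun s => f ![s, y]) (spd 0 f ![s, y]) s := by
  have h1 : HasDerivAt (fun s : ℝ => (![s, y] : Sp)) (Pi.single 0 1) s := by
    rw [hasDerivAt_pi]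
    intro i
    fin_cases i
    · simpa using hasDerivAt_id' s
    · simpa using hasDerivAt_const s y
  exact ((hf.differentiable (by simp)) _).hasFDerivAt.comp_hasDerivAt s h1

lemma hasDerivAt_spd_one {f : Sp → ℝ} (hf : ContDiff ℝ (⊤ : ℕ∞) f) (x s : ℝ) :
    HasDerivAt (fun s => f ![x, s]) (spd 1 f ![x, s]) s := by
  have h1 : HasDerivAt (fun s : ℝ => (![x, s] : Sp)) (Pi.single 1 1) s := by
    rw [hasDerivAt_pi]
    intro i
    fin_cases i
    · simpa using hasDerivAt_const s x
    · simpa using hasDerivAt_id' s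
  exact ((hf.differentiable (by simp)) _).hasFDerivAt.comp_hasDerivAt s h1

/-- Local Sobolev inequality at the corner of a square of side `h`, using only the mixed
second derivative. -/
lemma sq_corner_le {f : Sp → ℝ} (hf : ContDiff ℝ (⊤ : ℕ∞) f) {h : ℝ} (hh : 0 < h) (a b : ℝ) :
    f ![a, b] ^ 2 ≤ ∫ y in b..b + h, ∫ x in a..a + h,
      (4 / h ^ 2 * f ![x, y] ^ 2 + 2 * (spd 0 f ![x, y] ^ 2 + spd 1 f ![x, y] ^ 2)
        + h ^ 2 * spd 0 (spd 1 f) ![x, y] ^ 2) := by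
  have hc := hf.continuous
  have hc0 := (contDiff_spd hf 0).continuous
  have hc1 := (contDiff_spd hf 1).continuous
  have hc01 := (contDiff_spd (contDiff_spd hf 1) 0).continuous
  have hG : Continuous fun p : ℝ × ℝ =>
      (4 / h ^ 2 * f ![p.2, p.1] ^ 2 + 2 * (spd 0 f ![p.2, p.1] ^ 2 + spd 1 f ![p.2, p.1] ^ 2)
        + h ^ 2 * spd 0 (spd 1 f) ![p.2, p.1] ^ 2) := by fun_prop
  refine (sq_left_endpoint_le (hasDerivAt_spd_one hf a) (by fun_prop) hh b).trans ?_
  refine intervalIntegral.integral_mono_on (by linarith)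
    ((by fun_prop : Continuous _).intervalIntegrable _ _)
    ((intervalIntegral.continuous_parametric_intervalIntegral_of_continuous' hG a
      (a + h)).intervalIntegrable _ _) fun y _ => ?_
  have h1 := sq_left_endpoint_le (hasDerivAt_spd_zero hf y) (by fun_prop) hh a
  have h2 := sq_left_endpoint_le (hasDerivAt_spd_zero (contDiff_spd hf 1) y) (by fun_prop) hh a
  calc _ ≤ 2 / h * (∫ x in a..a + h, (2 / h * f ![x, y] ^ 2 + h * spd 0 f ![x, y] ^ 2))
        + h * (∫ x in a..a + h,
          (2 / h * spd 1 f ![x, y] ^ 2 + h * spd 0 (spd 1 f) ![x, y] ^ 2)) := by gcongr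
    _ = _ := by
      rw [← intervalIntegral.integral_const_mul, ← intervalIntegral.integral_const_mul,
        ← intervalIntegral.integral_add
          ((by fun_prop : Continuous _).intervalIntegrable _ _)
          ((by fun_prop : Continuous _).intervalIntegrable _ _)]
      congr 1
      ext x
      field_simp
      ring

lemma intervalIntegral_le_integral_of_le_on_square {F G : Sp → ℝ} (hF : Continuous F)
    (hG : Integrable G) (hG0 : ∀ x, 0 ≤ G x) {h : ℝ} (hh : 0 < h) (a b : ℝ)
    (hFG : ∀ x ∈ Set.Icc a (a + h), ∀ y ∈ Set.Icc b (b + h), F ![x, y] ≤ G ![x, y]) :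
    (∫ y in b..b + h, ∫ x in a..a + h, F ![x, y]) ≤ ∫ x, G x := by
  have hmp := (volume_preserving_finTwoArrow ℝ).symm
  have hGint : Integrable fun p : ℝ × ℝ => G ![p.1, p.2] :=
    hmp.integrable_comp_of_integrable hG
  have hGeq : ∫ x, G x = ∫ p : ℝ × ℝ, G ![p.1, p.2] :=
    (hmp.integral_comp' G).symm
  have hFc : Continuous fun p : ℝ × ℝ => F ![p.1, p.2] := by fun_prop
  have hFint : IntegrableOn (fun p : ℝ × ℝ => F ![p.1, p.2])
      (Set.Ioc a (a + h) ×ˢ Set.Ioc b (b + h)) :=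
    (hFc.continuousOn.integrableOn_compact (isCompact_Icc.prod isCompact_Icc)).mono_set
      (Set.prod_mono Set.Ioc_subset_Icc_self Set.Ioc_subset_Icc_self)
  have hiter : (∫ y in b..b + h, ∫ x in a..a + h, F ![x, y])
      = ∫ p in Set.Ioc a (a + h) ×ˢ Set.Ioc b (b + h), F ![p.1, p.2] := by
    rw [intervalIntegral.integral_of_le (by linarith)]
    simp_rw [intervalIntegral.integral_of_le (show a ≤ a + h by linarith)]
    rw [IntegrableOn, Measure.volume_eq_prod, ← Measure.prod_restrict] at hFint
    rw [Measure.volume_eq_prod, ← Measure.prod_restrict, integral_prod_symm _ hFint]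
  rw [hiter, hGeq]
  calc _ ≤ ∫ p in Set.Ioc a (a + h) ×ˢ Set.Ioc b (b + h), G ![p.1, p.2] :=
        setIntegral_mono_on hFint hGint.integrableOn
          (measurableSet_Ioc.prod measurableSet_Ioc) fun p hp =>
            hFG _ (Set.Ioc_subset_Icc_self hp.1) _ (Set.Ioc_subset_Icc_self hp.2)
    _ ≤ _ := setIntegral_le_integral hGint (.of_forall fun p => hG0 _)

lemma one_le_jb (s : ℝ) : 1 ≤ jb s :=
  Real.one_le_sqrt.2 (by nlinarith [sq_nonneg s])

lemma jb_le_jb_add_abs_sub (s r : ℝ) : jb s ≤ jb r + |s - r| := by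
  have hr : jb r ^ 2 = 1 + r ^ 2 := Real.sq_sqrt (by positivity)
  have hr1 : |r| ≤ jb r := Real.abs_le_sqrt (by linarith)
  refine Real.sqrt_le_iff.2 ⟨by linarith [one_le_jb r, abs_nonneg (s - r)], ?_⟩
  have h1 : r * (s - r) ≤ jb r * |s - r| :=
    (le_abs_self _).trans (by rw [abs_mul]; gcongr)
  nlinarith [sq_abs (s - r)]

lemma nrm2_le_add (x y : Sp) : nrm2 x ≤ nrm2 y + (|x 0 - y 0| + |x 1 - y 1|) := by
  have hy : nrm2 y ^ 2 = y 0 ^ 2 + y 1 ^ 2 := Real.sq_sqrt (by positivity)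
  have hn : 0 ≤ nrm2 y := Real.sqrt_nonneg _
  have h0 : |y 0| ≤ nrm2 y := Real.abs_le_sqrt (by nlinarith)
  have h1 : |y 1| ≤ nrm2 y := Real.abs_le_sqrt (by nlinarith)
  refine Real.sqrt_le_iff.2 ⟨by positivity, ?_⟩
  have e0 : y 0 * (x 0 - y 0) ≤ nrm2 y * |x 0 - y 0| :=
    (le_abs_self _).trans (by rw [abs_mul]; gcongr)
  have e1 : y 1 * (x 1 - y 1) ≤ nrm2 y * |x 1 - y 1| :=
    (le_abs_self _).trans (by rw [abs_mul]; gcongr)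
  nlinarith [sq_abs (x 0 - y 0), sq_abs (x 1 - y 1),
    mul_nonneg (abs_nonneg (x 0 - y 0)) (abs_nonneg (x 1 - y 1))]

lemma abs_nrm2_sub_le (x y : Sp) : |nrm2 x - nrm2 y| ≤ |x 0 - y 0| + |x 1 - y 1| := by
  have h1 := nrm2_le_add x y
  have h2 := nrm2_le_add y x
  rw [abs_sub_comm (y 0), abs_sub_comm (y 1)] at h2
  exact abs_le.2 ⟨by linarith, by linarith⟩

lemma continuous_jb_nrm2_sub (t : ℝ) : Continuous fun x : Sp => jb (nrm2 x - t) := by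
  unfold jb nrm2
  fun_prop

/-- Weighted Sobolev estimate: for f ∈ C_c^∞(ℝ²) and t ≥ 0,
⟨|x₀|−t⟩^{1/2} |f(x₀)| ≲ ‖f‖₂ + ‖⟨|x|−t⟩ ∇f‖₂ + ‖⟨|x|−t⟩ ∂₁∂₂ f‖₂. -/
theorem statement14 :
    ∃ C > (0 : ℝ), ∀ f : Sp → ℝ, ContDiff ℝ (⊤ : ℕ∞) f → HasCompactSupport f →
      ∀ t : ℝ, 0 ≤ t → ∀ x₀ : Sp,
        Real.sqrt (jb (nrm2 x₀ - t)) * |f x₀| ≤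
          C * (L2 f
            + Real.sqrt (∫ x : Sp, (jb (nrm2 x - t)) ^ 2 *
                ((spd 0 f x) ^ 2 + (spd 1 f x) ^ 2))
            + Real.sqrt (∫ x : Sp, (jb (nrm2 x - t)) ^ 2 *
                (spd 0 (spd 1 f) x) ^ 2)) := by
  refine ⟨8, by norm_num, fun f hf hfs t _ x₀ => ?_⟩
  have hc := hf.continuous
  have hc0 := (contDiff_spd hf 0).continuous
  have hc1 := (contDiff_spd hf 1).continuous
  have hc01 := (contDiff_spd (contDiff_spd hf 1) 0).continuous
  have hw := continuous_jb_nrm2_sub t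
  have hs0 := hasCompactSupport_spd hfs 0
  have hs1 := hasCompactSupport_spd hfs 1
  have hs01 := hasCompactSupport_spd hs1 0
  have hsq : ∀ {g : Sp → ℝ}, HasCompactSupport g → HasCompactSupport fun x => g x ^ 2 :=
    fun hg => hg.comp_left (g := fun r : ℝ => r ^ 2) (by norm_num)
  have hA : Integrable fun x => f x ^ 2 :=
    (by fun_prop : Continuous fun x => f x ^ 2).integrable_of_hasCompactSupport (hsq hfs)
  have hB : Integrable fun x : Sp => jb (nrm2 x - t) ^ 2 * (spd 0 f x ^ 2 + spd 1 f x ^ 2) :=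
    (by fun_prop : Continuous fun x : Sp =>
      jb (nrm2 x - t) ^ 2 * (spd 0 f x ^ 2 + spd 1 f x ^ 2)).integrable_of_hasCompactSupport
      (((hsq hs0).add (hsq hs1)).mul_left)
  have hD : Integrable fun x : Sp => jb (nrm2 x - t) ^ 2 * spd 0 (spd 1 f) x ^ 2 :=
    (by fun_prop : Continuous fun x : Sp =>
      jb (nrm2 x - t) ^ 2 * spd 0 (spd 1 f) x ^ 2).integrable_of_hasCompactSupport
      (hsq hs01).mul_left
  have hAB : Integrable fun x : Sp =>
      f x ^ 2 + jb (nrm2 x - t) ^ 2 * (spd 0 f x ^ 2 + spd 1 f x ^ 2) := hA.add hB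
  have hA0 : 0 ≤ ∫ x, f x ^ 2 := integral_nonneg fun x => by positivity
  have hB0 : 0 ≤ ∫ x : Sp, jb (nrm2 x - t) ^ 2 * (spd 0 f x ^ 2 + spd 1 f x ^ 2) :=
    integral_nonneg fun x => by positivity
  have hD0 : 0 ≤ ∫ x : Sp, jb (nrm2 x - t) ^ 2 * spd 0 (spd 1 f) x ^ 2 :=
    integral_nonneg fun x => by positivity
  obtain ⟨R, hR⟩ : ∃ R, jb (nrm2 x₀ - t) = R := ⟨_, rfl⟩
  have hR1 : 1 ≤ R := hR ▸ one_le_jb _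
  obtain ⟨h, hh⟩ : ∃ h, √R / 4 = h := ⟨_, rfl⟩
  have hh0 : 0 < h := by rw [← hh]; positivity
  have hhR : h ^ 2 = R / 16 := by
    rw [← hh, div_pow, Real.sq_sqrt (by linarith)]
    norm_num
  have hh4 : 2 * h ≤ R / 2 := by nlinarith
  have hx₀ : (![x₀ 0, x₀ 1] : Sp) = x₀ := by
    ext i; fin_cases i <;> rfl
  have hsquare := intervalIntegral_le_integral_of_le_on_square
    (F := fun z => 4 / h ^ 2 * f z ^ 2 + 2 * (spd 0 f z ^ 2 + spd 1 f z ^ 2)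
        + h ^ 2 * spd 0 (spd 1 f) z ^ 2)
    (G := fun z => 64 / R * (f z ^ 2 + jb (nrm2 z - t) ^ 2 * (spd 0 f z ^ 2 + spd 1 f z ^ 2)
      + jb (nrm2 z - t) ^ 2 * spd 0 (spd 1 f) z ^ 2))
    (by fun_prop) ((hAB.add hD).const_mul _) (fun z => by positivity) hh0 (x₀ 0) (x₀ 1)
    (fun x hx y hy => by
      obtain ⟨w, hwz⟩ : ∃ w, jb (nrm2 ![x, y] - t) = w := ⟨_, rfl⟩
      have hwR : R / 2 ≤ w := by
        have h1 := jb_le_jb_add_abs_sub (nrm2 x₀ - t) (nrm2 ![x, y] - t)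
        have h2 := abs_nrm2_sub_le x₀ ![x, y]
        have h3 : |x₀ 0 - x| ≤ h := abs_le.2 ⟨by linarith [hx.2], by linarith [hx.1]⟩
        have h4 : |x₀ 1 - y| ≤ h := abs_le.2 ⟨by linarith [hy.2], by linarith [hy.1]⟩
        simp only [Matrix.cons_val_zero, Matrix.cons_val_one] at h2
        rw [hR, hwz, sub_sub_sub_cancel_right] at h1
        linarith
      have hw2 : R ^ 2 / 4 ≤ w ^ 2 := by nlinarith
      simp only [hwz, hhR]
      have e1 : 4 / (R / 16) * f ![x, y] ^ 2 = 64 / R * f ![x, y] ^ 2 := by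
        field_simp
        ring
      have c1 : 2 ≤ 64 / R * w ^ 2 := by
        rw [div_mul_eq_mul_div, le_div_iff₀ (by linarith)]
        nlinarith
      have c2 : R / 16 ≤ 64 / R * w ^ 2 := by
        rw [div_mul_eq_mul_div, le_div_iff₀ (by linarith)]
        nlinarith
      rw [e1, mul_add (64 / R), mul_add (64 / R), ← mul_assoc (64 / R) (w ^ 2),
        ← mul_assoc (64 / R) (w ^ 2)]
      gcongr)
  have hkey := (sq_corner_le hf hh0 (x₀ 0) (x₀ 1)).trans hsquare
  rw [hx₀, integral_const_mul, integral_add hAB hD, integral_add hA hB,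
    div_mul_eq_mul_div, le_div_iff₀ (by linarith)] at hkey
  rw [hR, L2]
  generalize (∫ x : Sp, f x ^ 2) = A at *
  generalize (∫ x : Sp, jb (nrm2 x - t) ^ 2 * (spd 0 f x ^ 2 + spd 1 f x ^ 2)) = B at *
  generalize (∫ x : Sp, jb (nrm2 x - t) ^ 2 * spd 0 (spd 1 f) x ^ 2) = D at *
  refine abs_le_of_sq_le_sq' ?_ (by positivity) |>.2
  have p1 := mul_nonneg (Real.sqrt_nonneg A) (Real.sqrt_nonneg B)
  have p2 := mul_nonneg (Real.sqrt_nonneg A) (Real.sqrt_nonneg D)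
  have p3 := mul_nonneg (Real.sqrt_nonneg B) (Real.sqrt_nonneg D)
  rw [mul_pow, Real.sq_sqrt (by linarith), sq_abs]
  nlinarith [Real.sq_sqrt hA0, Real.sq_sqrt hB0, Real.sq_sqrt hD0]
end
end
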